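/- Let M be a finitely generated projective module of rank 9 over a commutative unital ring k, let x, y, z ∈ Λ₃(M), and let μ ∈ Λ₉(M*). Then e(x, (yz)·μ) + e(y, (zx)·μ) + e(z, (xy)·μ) = ((xyz)·μ) · Id_M in End_k(M), where (xyz)·μ ∈ k is the degree-0 scalar Δ'(xyz)(μ). -/

import Mathlib

open ExteriorAlgebra

/-- The algebra homomorphism `Δ : Λ(M*) → End(Λ(M))` extending the contraction
`φ ↦ Δ_φ`, so that `Δ(ξ)(x) = ξ·x`. -/
noncomputable def extDelta (R : Type*) [CommRing R] (M : Type*) [AddCommGroup M] [Module R M] :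
    ExteriorAlgebra R (Module.Dual R M) →ₐ[R] Module.End R (ExteriorAlgebra R M) :=
  ExteriorAlgebra.lift R ⟨CliffordAlgebra.contractLeft (Q := (0 : QuadraticForm R M)),
    fun d => LinearMap.ext fun x => CliffordAlgebra.contractLeft_contractLeft d x⟩

/-- The algebra homomorphism `Δ' : Λ(M) → End(Λ(M*))` obtained from contraction via
the canonical map `M → M**`, so that `Δ'(x)(ξ) = x·ξ`. -/
noncomputable def extDelta' (R : Type*) [CommRing R] (M : Type*) [AddCommGroup M] [Module R M] :
    ExteriorAlgebra R M →ₐ[R] Module.End R (ExteriorAlgebra R (Module.Dual R M)) :=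
  ExteriorAlgebra.lift R
    ⟨(CliffordAlgebra.contractLeft
        (Q := (0 : QuadraticForm R (Module.Dual R M)))).comp (Module.Dual.eval R M),
      fun _ => LinearMap.ext fun ξ => CliffordAlgebra.contractLeft_contractLeft _ ξ⟩

/-- The endomorphism `e(x,ξ)` of `M`, `m ↦ (m·ξ)·x`, where the result is viewed in
`M` via the (partial) inverse `ιInv` of `ι : M → Λ(M)`; for `x ∈ Λ_l(M)` and
`ξ ∈ Λ_l(M*)` the element `(m·ξ)·x` indeed lies in `Λ₁(M) = M`. -/
noncomputable def extE (R : Type*) [CommRing R] (M : Type*) [AddCommGroup M] [Module R M]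
    (x : ExteriorAlgebra R M) (ξ : ExteriorAlgebra R (Module.Dual R M)) :
    Module.End R M :=
  ιInv ∘ₗ LinearMap.applyₗ x ∘ₗ (extDelta R M).toLinearMap ∘ₗ
    LinearMap.applyₗ ξ ∘ₗ (extDelta' R M).toLinearMap ∘ₗ ι R

section Contraction

open CliffordAlgebra (involute)

variable {R M N : Type*} [CommRing R] [AddCommGroup M] [Module R M] [AddCommGroup N] [Module R N]

/-- The algebra homomorphism `Λ(N) → End(Λ(M))` extending the contractions by `B n`, for a
pairing `B : N → M*`. -/
noncomputable def extContract (B : N →ₗ[R] Module.Dual R M) :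
    ExteriorAlgebra R N →ₐ[R] Module.End R (ExteriorAlgebra R M) :=
  ExteriorAlgebra.lift R ⟨(CliffordAlgebra.contractLeft (Q := (0 : QuadraticForm R M))).comp B,
    fun _ => LinearMap.ext fun x => CliffordAlgebra.contractLeft_contractLeft _ x⟩

@[simp]
theorem extContract_ι (B : N →ₗ[R] Module.Dual R M) (n : N) (x : ExteriorAlgebra R M) :
    extContract B (ι R n) x = CliffordAlgebra.contractLeft (Q := (0 : QuadraticForm R M)) (B n) x := by
  simp only [extContract, ExteriorAlgebra.lift_ι_apply]
  rfl

theorem contractLeft_ι_mul (φ : Module.Dual R M) (m : M) (b : ExteriorAlgebra R M) :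
    CliffordAlgebra.contractLeft (Q := (0 : QuadraticForm R M)) φ (ι R m * b) =
      φ m • b - ι R m * CliffordAlgebra.contractLeft (Q := (0 : QuadraticForm R M)) φ b :=
  CliffordAlgebra.contractLeft_ι_mul ..

theorem contractLeft_mul (φ : Module.Dual R M) (a b : ExteriorAlgebra R M) :
    CliffordAlgebra.contractLeft φ (a * b) =
      CliffordAlgebra.contractLeft φ a * b + involute a * CliffordAlgebra.contractLeft φ b := by
  induction a using CliffordAlgebra.left_induction with
  | algebraMap r => simp [CliffordAlgebra.contractLeft_algebraMap_mul]
  | add a a' h h' => simp only [add_mul, map_add, h, h']; abel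
  | ι_mul a m h =>
    simp only [mul_assoc, CliffordAlgebra.contractLeft_ι_mul, h, map_mul,
      CliffordAlgebra.involute_ι, mul_add, sub_mul, neg_mul, smul_mul_assoc]
    abel

theorem contractLeft_involute (φ : Module.Dual R M) (a : ExteriorAlgebra R M) :
    CliffordAlgebra.contractLeft φ (involute a) = -involute (CliffordAlgebra.contractLeft φ a) := by
  induction a using CliffordAlgebra.left_induction with
  | algebraMap r => simp
  | add a a' h h' => simp only [map_add, h, h', neg_add]
  | ι_mul a m h =>
    simp only [CliffordAlgebra.contractLeft_ι_mul, h, map_mul, map_sub, map_smul,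
      CliffordAlgebra.involute_ι, map_neg, neg_mul, mul_neg]

theorem ι_mul_extContract (B : N →ₗ[R] Module.Dual R M) (m : M) (ξ : ExteriorAlgebra R N)
    (x : ExteriorAlgebra R M) :
    ι R m * extContract B ξ x =
      extContract B (CliffordAlgebra.contractLeft (Q := (0 : QuadraticForm R N)) (B.flip m) ξ) x +
        extContract B (involute ξ) (ι R m * x) := by
  induction ξ using CliffordAlgebra.left_induction with
  | algebraMap r => simp
  | add a a' h h' => simp only [map_add, LinearMap.add_apply, mul_add, h, h']; abel
  | ι_mul a n h =>
    have key : ι R m * CliffordAlgebra.contractLeft (Q := (0 : QuadraticForm R M)) (B n)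
        (extContract B a x) =
        B n m • extContract B a x -
          CliffordAlgebra.contractLeft (Q := (0 : QuadraticForm R M)) (B n)
            (ι R m * extContract B a x) := by
      rw [CliffordAlgebra.contractLeft_ι_mul]; abel
    simp only [CliffordAlgebra.contractLeft_ι_mul, map_mul, map_sub, map_smul, map_neg, neg_mul,
      CliffordAlgebra.involute_ι, Module.End.mul_apply, extContract_ι, LinearMap.sub_apply,
      LinearMap.smul_apply, LinearMap.neg_apply, key, h, map_add, LinearMap.flip_apply]
    abel

theorem involute_extContract (B : N →ₗ[R] Module.Dual R M) (ξ : ExteriorAlgebra R N)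
    (x : ExteriorAlgebra R M) :
    involute (extContract B ξ x) = extContract B (involute ξ) (involute x) := by
  induction ξ using CliffordAlgebra.left_induction with
  | algebraMap r => simp
  | add a a' h h' => simp only [map_add, LinearMap.add_apply, h, h']
  | ι_mul a n h =>
    simp only [map_mul, Module.End.mul_apply, extContract_ι, CliffordAlgebra.involute_ι, map_neg,
      LinearMap.neg_apply, ← h, contractLeft_involute, neg_mul, neg_neg]

@[simp]
theorem algebraMapInv_ι (m : M) : algebraMapInv (ι R m) = 0 := by
  simp [algebraMapInv]

theorem algebraMapInv_involute (x : ExteriorAlgebra R M) :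
    algebraMapInv (involute x) = algebraMapInv x := by
  induction x using CliffordAlgebra.left_induction with
  | algebraMap r => simp
  | add a a' h h' => simp only [map_add, h, h']
  | ι_mul a n h => simp

theorem ι_mul_eq_involute_mul (m : M) (w : ExteriorAlgebra R M) :
    ι R m * w = involute w * ι R m := by
  induction w using CliffordAlgebra.left_induction with
  | algebraMap r => simp [Algebra.commutes]
  | add a a' h h' => simp only [map_add, mul_add, add_mul, h, h']
  | ι_mul a n h =>
    have := eq_neg_of_add_eq_zero_left (ι_add_mul_swap (R := R) m n)
    rw [← mul_assoc, this, neg_mul, mul_assoc, h]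
    simp [mul_assoc]

theorem extContract_one (B : N →ₗ[R] Module.Dual R M) (ξ : ExteriorAlgebra R N) :
    extContract B ξ 1 = algebraMap R _ (algebraMapInv ξ) := by
  induction ξ using CliffordAlgebra.left_induction with
  | algebraMap r => simp [Algebra.algebraMap_eq_smul_one]
  | add a a' h h' => simp only [map_add, LinearMap.add_apply, h, h']
  | ι_mul a n h => simp [h]

/-- The two contractions attached to a pairing have the same scalar part. -/
theorem algebraMapInv_extContract (B : N →ₗ[R] Module.Dual R M) (ξ : ExteriorAlgebra R N)
    (x : ExteriorAlgebra R M) :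
    algebraMapInv (extContract B ξ x) = algebraMapInv (extContract B.flip x ξ) := by
  induction x using CliffordAlgebra.left_induction generalizing ξ with
  | algebraMap r =>
    rw [Algebra.algebraMap_eq_smul_one, map_smul, extContract_one]
    simp
  | add a a' h h' => simp only [map_add, LinearMap.add_apply, h, h']
  | ι_mul a m h =>
    have h1 := congrArg algebraMapInv (ι_mul_extContract B m (involute ξ) a)
    rw [map_mul, algebraMapInv_ι, zero_mul, map_add, CliffordAlgebra.involute_involute,
      contractLeft_involute, map_neg, LinearMap.neg_apply, map_neg, h, eq_comm,
      neg_add_eq_zero] at h1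
    rw [← h1, ← extContract_ι B.flip m ξ, ← algebraMapInv_involute, involute_extContract,
      CliffordAlgebra.involute_involute, ← Module.End.mul_apply, ← map_mul,
      ← ι_mul_eq_involute_mul]

theorem involute_of_mem {n : ℕ} {x : ExteriorAlgebra R M} (hx : x ∈ ⋀[R]^n M) :
    involute x = (-1) ^ n * x := by
  induction hx using Submodule.pow_induction_on_left' with
  | algebraMap r => simp
  | add a a' i _ _ h h' => simp only [map_add, mul_add, h, h']
  | mem_mul m hm i a _ h =>
    obtain ⟨m, rfl⟩ := hm
    rw [map_mul, h, CliffordAlgebra.involute_ι, pow_succ', ← mul_assoc, ← mul_assoc]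
    congr 1
    simpa using ((Commute.neg_one_right _).pow_right _).eq

theorem mul_eq_involute_iterate_mul_of_mem {n : ℕ} {x : ExteriorAlgebra R M} (hx : x ∈ ⋀[R]^n M)
    (w : ExteriorAlgebra R M) : x * w = involute^[n] w * x := by
  induction hx using Submodule.pow_induction_on_left' with
  | algebraMap r => simp [Algebra.commutes]
  | add a a' i _ _ h h' => simp only [add_mul, mul_add, h, h']
  | mem_mul m hm i a _ h =>
    obtain ⟨m, rfl⟩ := hm
    rw [mul_assoc, h, ← mul_assoc, ι_mul_eq_involute_mul, Function.iterate_succ_apply', mul_assoc]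

theorem ιInv_algebraMap (r : R) : ιInv (algebraMap R (ExteriorAlgebra R M) r) = 0 := by
  let : Module Rᵐᵒᵖ M := Module.compHom _ ((RingHom.id R).fromOpposite mul_comm)
  have : IsCentralScalar R M := ⟨fun r m => rfl⟩
  change (toTrivSqZeroExt (algebraMap R (ExteriorAlgebra R M) r)).snd = 0
  rw [AlgHom.commutes]
  rfl

theorem ιInv_ι_mul (m : M) (a : ExteriorAlgebra R M) :
    ιInv (ι R m * a) = algebraMapInv a • m := by
  let : Module Rᵐᵒᵖ M := Module.compHom _ ((RingHom.id R).fromOpposite mul_comm)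
  have : IsCentralScalar R M := ⟨fun r m => rfl⟩
  have hfst : (TrivSqZeroExt.fstHom R R M).comp toTrivSqZeroExt =
      (algebraMapInv : ExteriorAlgebra R M →ₐ[R] R) := by
    ext m
    simp
  change (toTrivSqZeroExt (ι R m * a)).snd = _
  rw [map_mul, toTrivSqZeroExt_ι, TrivSqZeroExt.snd_mul, ← hfst]
  simp

theorem dual_ιInv (φ : Module.Dual R M) (w : ExteriorAlgebra R M) :
    φ (ιInv w) =
      algebraMapInv (CliffordAlgebra.contractLeft (Q := (0 : QuadraticForm R M)) φ w) := by
  induction w using CliffordAlgebra.left_induction with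
  | algebraMap r => simp [ιInv_algebraMap]
  | add a a' h h' => simp only [map_add, h, h']
  | ι_mul a m h =>
    change φ (ιInv (ι R m * a)) =
      algebraMapInv (CliffordAlgebra.contractLeft (Q := (0 : QuadraticForm R M)) φ (ι R m * a))
    rw [contractLeft_ι_mul, map_sub, map_mul algebraMapInv, map_smul, algebraMapInv_ι,
      zero_mul, sub_zero, ιInv_ι_mul, map_smul, smul_eq_mul, smul_eq_mul, mul_comm]

theorem dual_extE (φ : Module.Dual R M) (m : M) (x : ExteriorAlgebra R M)
    (ξ : ExteriorAlgebra R (Module.Dual R M)) :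
    φ (extE R M x ξ m) = algebraMapInv (extDelta' R M x (ι R φ * extDelta' R M (ι R m) ξ)) := by
  have h := algebraMapInv_extContract (LinearMap.id : Module.Dual R M →ₗ[R] Module.Dual R M)
    (ι R φ * extDelta' R M (ι R m) ξ) x
  rw [map_mul, Module.End.mul_apply, extContract_ι, ← dual_ιInv] at h
  exact h

theorem ι_mul_extDelta' (φ : Module.Dual R M) (x : ExteriorAlgebra R M)
    (μ : ExteriorAlgebra R (Module.Dual R M)) :
    ι R φ * extDelta' R M x μ =
      extDelta' R M (CliffordAlgebra.contractLeft (Q := (0 : QuadraticForm R M)) φ x) μ +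
        extDelta' R M (involute x) (ι R φ * μ) :=
  ι_mul_extContract (Module.Dual.eval R M) φ x μ

theorem ι_mul_contractLeft_eq (m : M) (φ : Module.Dual R M) {w : ExteriorAlgebra R M}
    (hw : ι R m * w = 0) :
    ι R m * CliffordAlgebra.contractLeft (Q := (0 : QuadraticForm R M)) φ w = φ m • w := by
  have h := congrArg (CliffordAlgebra.contractLeft (Q := (0 : QuadraticForm R M)) φ) hw
  rw [CliffordAlgebra.contractLeft_ι_mul, map_zero, sub_eq_zero] at h
  exact h.symm

/-- An element that supercommutes as an odd element has central contractions. -/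
theorem contractLeft_mul_comm (φ : Module.Dual R M) {x : ExteriorAlgebra R M}
    (hx : involute x = -x) (hcomm : ∀ w, x * w = involute w * x) (w : ExteriorAlgebra R M) :
    CliffordAlgebra.contractLeft (Q := (0 : QuadraticForm R M)) φ x * w =
      w * CliffordAlgebra.contractLeft (Q := (0 : QuadraticForm R M)) φ x := by
  have h := congrArg (CliffordAlgebra.contractLeft (Q := (0 : QuadraticForm R M)) φ) (hcomm w)
  rw [contractLeft_mul, contractLeft_mul, contractLeft_involute,
    CliffordAlgebra.involute_involute, hx, neg_mul, neg_mul, hcomm, add_comm] at h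
  exact add_left_cancel h

theorem sum_mul_contractLeft_eq (φ : Module.Dual R M) (m : M) {x y z : ExteriorAlgebra R M}
    (hx : x ∈ ⋀[R]^3 M) (hy : y ∈ ⋀[R]^3 M) (hz : z ∈ ⋀[R]^3 M)
    (hm : ι R m * (x * y * z) = 0) :
    x * CliffordAlgebra.contractLeft (Q := (0 : QuadraticForm R M)) φ (ι R m * (y * z)) +
      y * CliffordAlgebra.contractLeft (Q := (0 : QuadraticForm R M)) φ (ι R m * (z * x)) +
      z * CliffordAlgebra.contractLeft (Q := (0 : QuadraticForm R M)) φ (ι R m * (x * y)) =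
    φ m • (x * y * z) := by
  have odd {x : ExteriorAlgebra R M} (hx : x ∈ ⋀[R]^3 M) : involute x = -x := by
    rw [involute_of_mem hx, Odd.neg_one_pow (by decide), neg_one_mul]
  have scomm {x : ExteriorAlgebra R M} (hx : x ∈ ⋀[R]^3 M) (w : ExteriorAlgebra R M) :
      x * w = involute w * x := by
    simpa using mul_eq_involute_iterate_mul_of_mem hx w
  have anti {x y : ExteriorAlgebra R M} (hx : x ∈ ⋀[R]^3 M) (hy : y ∈ ⋀[R]^3 M) :
      y * x = -(x * y) := by rw [scomm hy, odd hx, neg_mul]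
  have cm {x : ExteriorAlgebra R M} (hx : x ∈ ⋀[R]^3 M) :=
    contractLeft_mul_comm φ (odd hx) (scomm hx)
  have term {x y z : ExteriorAlgebra R M} (hx : x ∈ ⋀[R]^3 M) (hy : y ∈ ⋀[R]^3 M)
      (hz : z ∈ ⋀[R]^3 M) :
      x * CliffordAlgebra.contractLeft (Q := (0 : QuadraticForm R M)) φ (ι R m * (y * z)) =
        φ m • (x * y * z) - ι R m * (x * y * CliffordAlgebra.contractLeft φ z +
          z * x * CliffordAlgebra.contractLeft φ y) := by
    have hxm : x * ι R m = - (ι R m * x) := by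
      rw [scomm hx, CliffordAlgebra.involute_ι, neg_mul]
    rw [contractLeft_ι_mul, contractLeft_mul, odd hy, mul_sub, ← mul_assoc x (ι R m), hxm,
      cm hy, anti hx hz, mul_smul_comm, mul_assoc x y z]
    noncomm_ring
  have tot : CliffordAlgebra.contractLeft (Q := (0 : QuadraticForm R M)) φ (x * y * z) =
      x * y * CliffordAlgebra.contractLeft φ z + y * z * CliffordAlgebra.contractLeft φ x +
        z * x * CliffordAlgebra.contractLeft φ y := by
    rw [contractLeft_mul, contractLeft_mul, map_mul, odd hx, odd hy, anti hx hz, add_mul,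
      mul_assoc, cm hx, mul_assoc _ _ z, cm hy z]
    noncomm_ring
  have hyzx : y * z * x = x * y * z := by
    rw [mul_assoc, anti hx hz, mul_neg, ← mul_assoc, anti hx hy]; noncomm_ring
  have hzxy : z * x * y = x * y * z := by
    rw [anti hx hz, neg_mul, mul_assoc, anti hy hz]; noncomm_ring
  have key := ι_mul_contractLeft_eq m φ hm
  rw [tot] at key
  rw [term hx hy hz, term hy hz hx, term hz hx hy, hyzx, hzxy, ← key]
  noncomm_ring

end Contraction

section Vanishing

variable {R M F : Type*} [CommRing R] [AddCommGroup M] [Module R M] [AddCommGroup F] [Module R F]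

theorem alternatingMap_eq_zero_of_card_lt {ι κ : Type*} [Finite ι] [Finite κ]
    (b : Module.Basis κ R F) (h : Nat.card κ < Nat.card ι) {N : Type*} [AddCommGroup N]
    [Module R N] (f : F [⋀^ι]→ₗ[R] N) : f = 0 :=
  b.ext_alternating fun v hv => absurd (Nat.card_le_card_of_injective v hv) (not_le.mpr h)

/-- If multiplication by `s` factors through a free module of rank `< n`, then `s ^ n` kills the
`n`-th exterior power. -/
theorem pow_smul_eq_zero_of_factor {κ : Type*} [Finite κ] (b : Module.Basis κ R F) {n : ℕ}
    (hn : Nat.card κ < n) (s : R) (g : M →ₗ[R] F) (h : F →ₗ[R] M)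
    (hgh : h ∘ₗ g = s • LinearMap.id) {w : ExteriorAlgebra R M} (hw : w ∈ ⋀[R]^n M) :
    s ^ n • w = 0 := by
  rw [← ιMulti_span_fixedDegree] at hw
  induction hw using Submodule.span_induction with
  | mem w hw =>
    obtain ⟨v, rfl⟩ := hw
    have h1 : ((ιMulti R n).compLinearMap h) (fun i => g (v i)) = 0 := by
      rw [alternatingMap_eq_zero_of_card_lt b (by simpa using hn) ((ιMulti R n).compLinearMap h)]
      rfl
    have h2 (i : Fin n) : h (g (v i)) = s • v i := LinearMap.congr_fun hgh (v i)
    simpa [h2, AlternatingMap.map_smul_univ] using h1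
  | zero => simp
  | add a a' _ _ h h' => rw [smul_add, h, h', add_zero]
  | smul r a _ h => rw [smul_comm, h, smul_zero]

theorem exists_smul_eq_comp_of_localized [Module.Finite R M] [Module.Projective R M]
    (S : Submonoid R) {n : ℕ}
    (b : Module.Basis (Fin n) (Localization S) (LocalizedModule S M)) :
    ∃ s ∈ S, ∃ (g : M →ₗ[R] (Fin n → R)) (h : (Fin n → R) →ₗ[R] M),
      h ∘ₗ g = s • LinearMap.id := by
  have hb (i : Fin n) : ∃ (a : M) (t : S), LocalizedModule.mk a t = b i := by
    induction h : b i using LocalizedModule.induction_on with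
    | h a t => exact ⟨a, t, rfl⟩
  choose a t hat using hb
  let h : (Fin n → R) →ₗ[R] M := Fintype.linearCombination R a
  have hmem (m : M) : ∃ s ∈ S, s • m ∈ LinearMap.range h := by
    obtain ⟨d, hd⟩ := IsLocalization.exist_integer_multiples_of_finite S
      (fun i => b.repr (LocalizedModule.mk m 1) i * Localization.mk 1 (t i))
    choose r hr using hd
    have hsum := b.sum_repr (LocalizedModule.mk m 1)
    have hd' : LocalizedModule.mk ((d : R) • m) (1 : S) = LocalizedModule.mk (∑ i, r i • a i) 1 := by
      change _ = LocalizedModule.mkLinearMap S M (∑ i, r i • a i)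
      rw [map_sum, ← LocalizedModule.smul'_mk, ← hsum, Finset.smul_sum]
      refine Finset.sum_congr rfl fun i _ => ?_
      rw [map_smul, ← algebraMap_smul (Localization S) (r i), hr, smul_assoc, mul_smul, ← hat,
        LocalizedModule.mkLinearMap_apply, LocalizedModule.mk_smul_mk, one_smul, mul_one]
    obtain ⟨u, hu⟩ := LocalizedModule.mk_eq.mp hd'
    refine ⟨u * d, mul_mem u.2 d.2, u.1 • r, ?_⟩
    simp only [one_smul] at hu
    rw [map_smul, mul_smul]
    exact hu.symm
  choose s hs hsm using hmem
  obtain ⟨T, hT⟩ := Module.Finite.fg_top (R := R) (M := M)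
  let s₀ := ∏ m ∈ T, s m
  have hs₀ (m : M) : s₀ • m ∈ LinearMap.range h := by
    have : Submodule.span R (T : Set M) ≤
        (LinearMap.range h).comap (LinearMap.lsmul R M s₀) := by
      refine Submodule.span_le.mpr fun m hm => ?_
      obtain ⟨c, hc⟩ := Finset.dvd_prod_of_mem s hm
      change s₀ • m ∈ LinearMap.range h
      rw [show s₀ = c * s m from hc.trans (mul_comm _ _), mul_smul]
      exact Submodule.smul_mem _ _ (hsm m)
    exact this (hT ▸ Submodule.mem_top)
  obtain ⟨g, hg⟩ := Module.projective_lifting_property h.rangeRestrict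
    ((s₀ • LinearMap.id : M →ₗ[R] M).codRestrict _ hs₀) h.surjective_rangeRestrict
  refine ⟨s₀, prod_mem fun m _ => hs m, g, h, LinearMap.ext fun m => ?_⟩
  exact congrArg Subtype.val (LinearMap.congr_fun hg m)

theorem eq_zero_of_forall_prime_smul {N : Type*} [AddCommGroup N] [Module R N] (w : N)
    (h : ∀ (p : Ideal R) [p.IsPrime], ∃ s ∈ p.primeCompl, s • w = 0) : w = 0 := by
  by_contra hw
  obtain ⟨p, hp, hle⟩ := Ideal.exists_le_maximal (Ideal.torsionOf R N w)
    (by rwa [Ne, Ideal.torsionOf_eq_top_iff])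
  have := hp.isPrime
  obtain ⟨s, hs, hsw⟩ := h p
  exact hs (hle ((Ideal.mem_torsionOf_iff w s).mpr hsw))

theorem exists_smul_eq_comp_of_rank [Module.Finite R M] [Module.Projective R M] {n : ℕ}
    (p : Ideal R) [p.IsPrime]
    (hrank : Module.Free (Localization.AtPrime p) (LocalizedModule p.primeCompl M) ∧
      Module.finrank (Localization.AtPrime p) (LocalizedModule p.primeCompl M) = n) :
    ∃ s ∈ p.primeCompl, ∃ (g : M →ₗ[R] (Fin n → R)) (h : (Fin n → R) →ₗ[R] M),
      h ∘ₗ g = s • LinearMap.id := by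
  have := hrank.1
  have : Module.Finite (Localization.AtPrime p) (LocalizedModule p.primeCompl M) :=
    Module.Finite.of_isLocalizedModule p.primeCompl (LocalizedModule.mkLinearMap p.primeCompl M)
  exact exists_smul_eq_comp_of_localized p.primeCompl
    (Module.finBasisOfFinrankEq _ _ hrank.2)

theorem eq_zero_of_mem_exteriorPower
    [Module.Finite R M] [Module.Projective R M] {n : ℕ}
    (hrank : ∀ (p : Ideal R) [p.IsPrime],
      Module.Free (Localization.AtPrime p) (LocalizedModule p.primeCompl M) ∧
      Module.finrank (Localization.AtPrime p) (LocalizedModule p.primeCompl M) = n)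
    {l : ℕ} (hl : n < l) {w : ExteriorAlgebra R M}
    (hw : w ∈ ⋀[R]^l M) : w = 0 := by
  refine eq_zero_of_forall_prime_smul (R := R) w fun p _ => ?_
  obtain ⟨s, hs, g, h, hgh⟩ := exists_smul_eq_comp_of_rank p (hrank p)
  exact ⟨s ^ l, pow_mem hs l,
    pow_smul_eq_zero_of_factor (Pi.basisFun R (Fin n)) (by simpa using hl) s g h hgh hw⟩

theorem eq_zero_of_mem_exteriorPower_dual
    [Module.Finite R M] [Module.Projective R M] {n : ℕ}
    (hrank : ∀ (p : Ideal R) [p.IsPrime],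
      Module.Free (Localization.AtPrime p) (LocalizedModule p.primeCompl M) ∧
      Module.finrank (Localization.AtPrime p) (LocalizedModule p.primeCompl M) = n)
    {l : ℕ} (hl : n < l)
    {w : ExteriorAlgebra R (Module.Dual R M)} (hw : w ∈ ⋀[R]^l (Module.Dual R M)) : w = 0 := by
  refine eq_zero_of_forall_prime_smul (R := R) w fun p _ => ?_
  obtain ⟨s, hs, g, h, hgh⟩ := exists_smul_eq_comp_of_rank p (hrank p)
  refine ⟨s ^ l, pow_mem hs l,
    pow_smul_eq_zero_of_factor (Pi.basisFun R (Fin n)).dualBasis (by simpa using hl) s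
      h.dualMap g.dualMap ?_ hw⟩
  ext φ m
  simpa using congrArg φ (LinearMap.congr_fun hgh m)

end Vanishing

/-- **Statement 17.** For a finitely generated projective module `M` of rank `9`,
`x, y, z ∈ Λ₃(M)` and `μ ∈ Λ₉(M*)`, one has
`e(x,(yz)·μ) + e(y,(zx)·μ) + e(z,(xy)·μ) = ((xyz)·μ)·Id_M` in `End(M)`, where
`(xyz)·μ ∈ k` is the degree-0 scalar `Δ'(xyz)(μ)`. -/
theorem extE_cyclic_sum_eq_smul_id
    (R : Type*) [CommRing R] (M : Type*) [AddCommGroup M] [Module R M]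
    [Module.Finite R M] [Module.Projective R M]
    (hrank : ∀ (p : Ideal R) [p.IsPrime],
      Module.Free (Localization.AtPrime p) (LocalizedModule p.primeCompl M) ∧
      Module.finrank (Localization.AtPrime p) (LocalizedModule p.primeCompl M) = 9)
    (x y z : ExteriorAlgebra R M)
    (hx : x ∈ ⋀[R]^3 M) (hy : y ∈ ⋀[R]^3 M) (hz : z ∈ ⋀[R]^3 M)
    (μ : ExteriorAlgebra R (Module.Dual R M)) (hμ : μ ∈ ⋀[R]^9 (Module.Dual R M))
    (c : R)
    (hc : extDelta' R M (x * y * z) μ = algebraMap R (ExteriorAlgebra R (Module.Dual R M)) c) :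
    extE R M x (extDelta' R M (y * z) μ) + extE R M y (extDelta' R M (z * x) μ) +
      extE R M z (extDelta' R M (x * y) μ) = c • (LinearMap.id : M →ₗ[R] M) := by
  have hφμ (φ : Module.Dual R M) : ι R φ * μ = 0 := by
    refine eq_zero_of_mem_exteriorPower_dual hrank (l := 9 + 1) (by lia) ?_
    rw [exteriorPower, pow_succ']
    exact Submodule.mul_mem_mul (LinearMap.mem_range_self _ φ) hμ
  have hxyz (m : M) : ι R m * (x * y * z) = 0 := by
    refine eq_zero_of_mem_exteriorPower hrank (l := 3 + 3 + 3 + 1) (by lia) ?_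
    rw [exteriorPower, pow_succ', pow_add _ (3 + 3) 3, pow_add _ 3 3]
    exact Submodule.mul_mem_mul (LinearMap.mem_range_self _ m)
      (Submodule.mul_mem_mul (Submodule.mul_mem_mul hx hy) hz)
  have term (φ : Module.Dual R M) (m : M) (a b : ExteriorAlgebra R M) :
      φ (extE R M a (extDelta' R M b μ) m) = algebraMapInv (extDelta' R M
        (a * CliffordAlgebra.contractLeft (Q := (0 : QuadraticForm R M)) φ (ι R m * b)) μ) := by
    rw [dual_extE, ← Module.End.mul_apply, ← map_mul, ι_mul_extDelta', hφμ, map_zero, add_zero,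
      ← Module.End.mul_apply, ← map_mul]
  ext m
  rw [← sub_eq_zero, ← Module.forall_dual_apply_eq_zero_iff R]
  intro φ
  simp only [map_sub, LinearMap.add_apply, map_add, term, LinearMap.smul_apply, LinearMap.id_apply,
    map_smul, smul_eq_mul]
  rw [← map_add, ← LinearMap.add_apply, ← map_add, ← map_add, ← LinearMap.add_apply, ← map_add,
    sum_mul_contractLeft_eq φ m hx hy hz (hxyz m), map_smul, LinearMap.smul_apply, hc]
  simp [mul_comm]
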